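/- Suppose the monomial weight x^A is partial, with α_j = 0 exactly for j in a nonempty set J ⊆ {1,…,N}, and let λ > 0. Then for every function of the form v(x) = a + Σ_{j∈J} a_j x_j with some a_j ≠ 0, v is non-constant and equality holds in the scale-dependent Poincaré inequality: ∫_{ℝ^N_*} |∇v|² dμ_{A,λ} = (1/λ²) inf over c ∈ ℝ of ∫_{ℝ^N_*} |v − c|² dμ_{A,λ}. -/

import Mathlib

open MeasureTheory Real

noncomputable section

/-- The Weyl chamber associated to the monomial weight with exponents `α`. -/
def chamber {N : ℕ} (α : Fin N → ℝ) : Set (EuclideanSpace ℝ (Fin N)) :=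
  {x | ∀ i, 0 < α i → 0 < x i}

/-- The monomial weight `x^A = x₁^{α₁} ⋯ x_N^{α_N}`. -/
def monWeight {N : ℕ} (α : Fin N → ℝ) (x : EuclideanSpace ℝ (Fin N)) : ℝ :=
  ∏ i, x i ^ α i

/-- The scale-dependent monomial Gaussian probability measure
`dμ_{A,λ} = x^A e^{-|x|²/(2λ²)} dx / ∫_{ℝ^N_*} x^A e^{-|x|²/(2λ²)} dx`. -/
def monGaussScaled {N : ℕ} (α : Fin N → ℝ) (lam : ℝ) : Measure (EuclideanSpace ℝ (Fin N)) :=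
  (((MeasureTheory.volume.restrict (chamber α)).withDensity
      (fun x => ENNReal.ofReal (monWeight α x * Real.exp (-‖x‖ ^ 2 / (2 * lam ^ 2))))) Set.univ)⁻¹ •
  ((MeasureTheory.volume.restrict (chamber α)).withDensity
      (fun x => ENNReal.ofReal (monWeight α x * Real.exp (-‖x‖ ^ 2 / (2 * lam ^ 2)))))

/-- Membership in the class `N_*`: smooth, compactly supported, with vanishing normal
component of the gradient on the boundary of the Weyl chamber. -/
def NstarClass {N : ℕ} (α : Fin N → ℝ) (u : EuclideanSpace ℝ (Fin N) → ℝ) : Prop :=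
  ContDiff ℝ (⊤ : ℕ∞) u ∧ HasCompactSupport u ∧
    ∀ x : EuclideanSpace ℝ (Fin N), ∀ i, 0 < α i → x i = 0 →
      fderiv ℝ u x (EuclideanSpace.single i 1) = 0

end

open ProbabilityTheory in
/-- The variance is the minimum over `c` of the second moments about `c`. -/
theorem iInf_integral_sub_sq_eq_variance {Ω : Type*} [MeasurableSpace Ω] {μ : Measure Ω}
    [IsProbabilityMeasure μ] {X : Ω → ℝ} (hX : MemLp X 2 μ) :
    ⨅ c : ℝ, ∫ ω, (X ω - c) ^ 2 ∂μ = Var[X; μ] := by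
  have key (c : ℝ) : ∫ ω, (X ω - c) ^ 2 ∂μ = Var[X; μ] + (∫ ω, X ω ∂μ - c) ^ 2 := by
    have h := variance_eq_sub (hX.sub (memLp_const c))
    have hv : Var[X - fun _ => c; μ] = Var[X; μ] := variance_sub_const hX.1 c
    have hm : ∫ ω, (X - fun _ : Ω => c) ω ∂μ = ∫ ω, X ω ∂μ - c := by
      simp [integral_sub (hX.integrable (by norm_num)) (integrable_const c)]
    rw [hv, hm] at h
    have h' : ∫ ω, ((X - fun _ : Ω => c) ^ 2) ω ∂μ = ∫ ω, (X ω - c) ^ 2 ∂μ := rfl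
    linarith
  simp_rw [key]
  apply le_antisymm
  · refine (ciInf_le ⟨Var[X; μ], ?_⟩ (∫ ω, X ω ∂μ)).trans (by simp)
    rintro _ ⟨c, rfl⟩
    exact le_add_of_nonneg_right (sq_nonneg _)
  · exact le_ciInf fun c => le_add_of_nonneg_right (sq_nonneg _)

/-- A product of measures with integrable densities has the product density. -/
theorem pi_withDensity_ofReal {ι : Type*} [Fintype ι] {g : ι → ℝ → ℝ}
    (hg : ∀ i, Integrable (g i)) (hg0 : ∀ i x, 0 ≤ g i x) :
    Measure.pi (fun i => (volume : Measure ℝ).withDensity fun x => ENNReal.ofReal (g i x)) =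
      (volume : Measure (ι → ℝ)).withDensity fun x => ENNReal.ofReal (∏ i, g i (x i)) := by
  have (i : ι) : IsFiniteMeasure
      ((volume : Measure ℝ).withDensity fun x => ENNReal.ofReal (g i x)) :=
    isFiniteMeasure_withDensity_ofReal (hg i).2
  refine Measure.pi_eq fun s hs => ?_
  rw [withDensity_apply _ (MeasurableSet.univ_pi hs), volume_pi, Measure.restrict_pi_pi,
    ← ofReal_integral_eq_lintegral_ofReal
      (Integrable.fintype_prod fun i => (hg i).restrict)
      (Filter.Eventually.of_forall fun x => Finset.prod_nonneg fun i _ => hg0 i _),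
    integral_fintype_prod_eq_prod,
    ENNReal.ofReal_prod_of_nonneg fun i _ => integral_nonneg (hg0 i)]
  refine Finset.prod_congr rfl fun i _ => ?_
  rw [withDensity_apply _ (hs i), ofReal_integral_eq_lintegral_ofReal (hg i).restrict
    (Filter.Eventually.of_forall (hg0 i))]

/-- The one-dimensional factor `x^α e^{-x²/(2λ²)}`, cut off to `x > 0` when `α > 0`. -/
noncomputable def monGaussFactor (α lam : ℝ) : ℝ → ℝ :=
  {x | 0 < α → 0 < x}.indicator fun x => x ^ α * Real.exp (-x ^ 2 / (2 * lam ^ 2))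

theorem monGaussFactor_nonneg {α : ℝ} (hα : 0 ≤ α) (lam x : ℝ) :
    0 ≤ monGaussFactor α lam x := by
  refine Set.indicator_nonneg (fun x hx => mul_nonneg ?_ (Real.exp_nonneg _)) x
  rcases hα.eq_or_lt with rfl | h
  · simp
  · exact Real.rpow_nonneg (hx h).le _

theorem measurableSet_halfLine (α : ℝ) : MeasurableSet {x : ℝ | 0 < α → 0 < x} := by
  by_cases h : 0 < α
  · simp only [h, forall_const]
    exact measurableSet_Ioi
  · simp [h]

theorem integrable_monGaussFactor {α lam : ℝ} (hα : 0 ≤ α) (hlam : 0 < lam) :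
    Integrable (monGaussFactor α lam) := by
  refine Integrable.indicator ?_ (measurableSet_halfLine α)
  have h := integrable_rpow_mul_exp_neg_mul_sq (b := 1 / (2 * lam ^ 2)) (by positivity)
    (s := α) (by linarith)
  have hexp (x : ℝ) : -x ^ 2 / (2 * lam ^ 2) = -(1 / (2 * lam ^ 2)) * x ^ 2 := by ring
  simpa only [hexp] using h

theorem integral_monGaussFactor_pos {α lam : ℝ} (hα : 0 ≤ α) (hlam : 0 < lam) :
    0 < ∫ x, monGaussFactor α lam x := by
  rw [integral_pos_iff_support_of_nonneg (monGaussFactor_nonneg hα lam)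
    (integrable_monGaussFactor hα hlam)]
  refine lt_of_lt_of_le (by simp) (measure_mono (s := Set.Ioi (0 : ℝ)) fun x hx => ?_)
  have hx' : 0 < x := hx
  have : monGaussFactor α lam x = x ^ α * Real.exp (-x ^ 2 / (2 * lam ^ 2)) :=
    Set.indicator_of_mem (s := {x : ℝ | 0 < α → 0 < x}) (fun _ => hx') _
  rw [Function.mem_support, this]
  positivity

/-- The normalized one-dimensional factor as a probability measure. -/
noncomputable def monGaussMarginal (α lam : ℝ) : Measure ℝ :=
  volume.withDensity fun x =>
    ENNReal.ofReal ((∫ y, monGaussFactor α lam y)⁻¹ * monGaussFactor α lam x)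

theorem isProbabilityMeasure_monGaussMarginal {α lam : ℝ} (hα : 0 ≤ α) (hlam : 0 < lam) :
    IsProbabilityMeasure (monGaussMarginal α lam) := by
  constructor
  have hpos := integral_monGaussFactor_pos hα hlam
  rw [monGaussMarginal, withDensity_apply _ MeasurableSet.univ, Measure.restrict_univ,
    ← ofReal_integral_eq_lintegral_ofReal ((integrable_monGaussFactor hα hlam).const_mul _)
      (Filter.Eventually.of_forall fun x =>
        mul_nonneg (inv_nonneg.2 hpos.le) (monGaussFactor_nonneg hα lam x)),
    integral_const_mul, inv_mul_cancel₀ hpos.ne', ENNReal.ofReal_one]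

open ProbabilityTheory in
theorem monGaussMarginal_zero {lam : ℝ} (hlam : 0 < lam) :
    monGaussMarginal 0 lam = gaussianReal 0 (lam ^ 2).toNNReal := by
  have hv : (lam ^ 2).toNNReal ≠ 0 := by simpa using hlam.ne'
  have hc : ((lam ^ 2).toNNReal : ℝ) = lam ^ 2 := Real.coe_toNNReal _ (sq_nonneg _)
  have hf : monGaussFactor 0 lam = fun x => Real.exp (-x ^ 2 / (2 * lam ^ 2)) := by
    ext x; simp [monGaussFactor]
  have hg : gaussianPDFReal 0 (lam ^ 2).toNNReal =
      fun x => (√(2 * π * lam ^ 2))⁻¹ * Real.exp (-x ^ 2 / (2 * lam ^ 2)) := by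
    ext x; simp [gaussianPDFReal, hc]
  have h1 := integral_gaussianPDFReal_eq_one 0 hv
  rw [hg, integral_const_mul] at h1
  rw [gaussianReal_of_var_ne_zero _ hv, gaussianPDF_def, hg, monGaussMarginal, hf,
    ← eq_inv_of_mul_eq_one_left h1]

/-- The scaled monomial Gaussian measure is the product of its marginals. -/
theorem monGaussScaled_eq_map_pi {N : ℕ} {α : Fin N → ℝ} (hα : ∀ i, 0 ≤ α i) {lam : ℝ}
    (hlam : 0 < lam) :
    monGaussScaled α lam =
      (Measure.pi fun i => monGaussMarginal (α i) lam).map (WithLp.toLp 2) := by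
  have hprob (i : Fin N) := isProbabilityMeasure_monGaussMarginal (hα i) hlam
  set I : Fin N → ℝ := fun i => ∫ y, monGaussFactor (α i) lam y
  have hI (i : Fin N) : 0 < I i := integral_monGaussFactor_pos (hα i) hlam
  have hIprod : 0 < ∏ i, I i := Finset.prod_pos fun i _ => hI i
  have hchamber : MeasurableSet (chamber α) := by
    have : chamber α = ⋂ i, (fun x : EuclideanSpace ℝ (Fin N) => x i) ⁻¹'
        {t : ℝ | 0 < α i → 0 < t} := by
      ext x; simp [chamber]
    rw [this]
    exact MeasurableSet.iInter fun i =>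
      (measurableSet_halfLine (α i)).preimage (by fun_prop)
  have hdens (x : EuclideanSpace ℝ (Fin N)) :
      (chamber α).indicator (fun x => ENNReal.ofReal
        (monWeight α x * Real.exp (-‖x‖ ^ 2 / (2 * lam ^ 2)))) x =
      ENNReal.ofReal (∏ i, I i) *
        ENNReal.ofReal (∏ i, (I i)⁻¹ * monGaussFactor (α i) lam (x i)) := by
    rw [← ENNReal.ofReal_mul hIprod.le, ← Finset.prod_mul_distrib]
    have : ∀ i, I i * ((I i)⁻¹ * monGaussFactor (α i) lam (x i)) =
        monGaussFactor (α i) lam (x i) := fun i => mul_inv_cancel_left₀ (hI i).ne' _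
    simp_rw [this]
    by_cases hx : x ∈ chamber α
    · rw [Set.indicator_of_mem hx]
      have (i : Fin N) : monGaussFactor (α i) lam (x i) =
          x i ^ α i * Real.exp (-x i ^ 2 / (2 * lam ^ 2)) :=
        Set.indicator_of_mem (s := {x : ℝ | 0 < α i → 0 < x}) (hx i) _
      simp_rw [this]
      rw [Finset.prod_mul_distrib, ← Real.exp_sum, monWeight, EuclideanSpace.real_norm_sq_eq,
        ← Finset.sum_div, Finset.sum_neg_distrib]
    · rw [Set.indicator_of_notMem hx]
      obtain ⟨i, hi⟩ : ∃ i, ¬ (0 < α i → 0 < x i) := by simpa [chamber] using hx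
      rw [Finset.prod_eq_zero (Finset.mem_univ i)
        (Set.indicator_of_notMem (s := {x : ℝ | 0 < α i → 0 < x}) hi _), ENNReal.ofReal_zero]
  have hW : (volume.restrict (chamber α)).withDensity
      (fun x => ENNReal.ofReal (monWeight α x * Real.exp (-‖x‖ ^ 2 / (2 * lam ^ 2)))) =
      ENNReal.ofReal (∏ i, I i) •
        (Measure.pi fun i => monGaussMarginal (α i) lam).map (WithLp.toLp 2) := by
    have hm (i : Fin N) : Measurable (monGaussFactor (α i) lam) :=
      Measurable.indicator (by fun_prop) (measurableSet_halfLine (α i))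
    have hmeas : Measurable fun x : EuclideanSpace ℝ (Fin N) =>
        ENNReal.ofReal (∏ i, (I i)⁻¹ * monGaussFactor (α i) lam (x i)) := by
      refine ENNReal.measurable_ofReal.comp (Finset.measurable_prod _ fun i _ => ?_)
      exact ((hm i).comp (by fun_prop)).const_mul _
    rw [← withDensity_indicator hchamber, funext hdens]
    change volume.withDensity (ENNReal.ofReal (∏ i, I i) • fun x : EuclideanSpace ℝ (Fin N) =>
      ENNReal.ofReal (∏ i, (I i)⁻¹ * monGaussFactor (α i) lam (x i))) = _
    rw [withDensity_smul _ hmeas]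
    congr 1
    unfold monGaussMarginal
    rw [pi_withDensity_ofReal
      (fun i => (integrable_monGaussFactor (hα i) hlam).const_mul _)
      (fun i x => mul_nonneg (inv_nonneg.2 (hI i).le) (monGaussFactor_nonneg (hα i) lam x))]
    ext s hs
    have hp := PiLp.volume_preserving_toLp (Fin N)
    rw [Measure.map_apply hp.measurable hs, withDensity_apply _ hs,
      withDensity_apply _ (hp.measurable hs), ← hp.setLIntegral_comp_preimage hs hmeas]
  have hc0 : ENNReal.ofReal (∏ i, I i) ≠ 0 := by simpa using hIprod
  have : IsProbabilityMeasure
      ((Measure.pi fun i => monGaussMarginal (α i) lam).map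
        (WithLp.toLp 2 : (Fin N → ℝ) → EuclideanSpace ℝ (Fin N))) :=
    Measure.isProbabilityMeasure_map
      (PiLp.volume_preserving_toLp (Fin N)).measurable.aemeasurable
  rw [monGaussScaled, hW, Measure.smul_apply, measure_univ, smul_eq_mul, mul_one, smul_smul,
    ENNReal.inv_mul_cancel hc0 ENNReal.ofReal_ne_top, one_smul]

theorem gradient_affine {N : ℕ} (a : ℝ) (b : Fin N → ℝ) (x : EuclideanSpace ℝ (Fin N)) :
    gradient (fun x : EuclideanSpace ℝ (Fin N) => a + ∑ j, b j * x j) x = WithLp.toLp 2 b := by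
  refine HasGradientAt.gradient ?_
  rw [hasGradientAt_iff_hasFDerivAt]
  have h : (fun x : EuclideanSpace ℝ (Fin N) => a + ∑ j, b j * x j) =
      fun x => a + (InnerProductSpace.toDual ℝ (EuclideanSpace ℝ (Fin N)) (WithLp.toLp 2 b)) x := by
    ext x
    simp [PiLp.inner_apply, mul_comm]
  rw [h]
  exact (ContinuousLinearMap.hasFDerivAt _).const_add a

/-- If the monomial weight is partial (with `α_j = 0` exactly for `j ∈ J`), the
scale-dependent Poincaré inequality with monomial Gaussian weight is attained with
equality by the non-constant functions `v(x) = a + Σ_{j∈J} a_j x_j`. -/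
theorem scale_poincare_monomial_gaussian_attained {N : ℕ} (hN : 1 ≤ N) (α : Fin N → ℝ)
    (hα : ∀ i, 0 ≤ α i) (hpartial : ∃ i, α i = 0) (lam : ℝ) (hlam : 0 < lam)
    (a : ℝ) (aj : Fin N → ℝ) (hsupp : ∀ j, α j ≠ 0 → aj j = 0)
    (hne : ∃ j, α j = 0 ∧ aj j ≠ 0) :
    let v : EuclideanSpace ℝ (Fin N) → ℝ := fun x => a + ∑ j, aj j * x j
    (∃ x y, v x ≠ v y) ∧
    ∫ x, ‖gradient v x‖ ^ 2 ∂(monGaussScaled α lam) =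
      (1 / lam ^ 2) * ⨅ c : ℝ, ∫ x, (v x - c) ^ 2 ∂(monGaussScaled α lam) := by
  intro v
  refine ⟨?_, ?_⟩
  · obtain ⟨j, -, hj⟩ := hne
    refine ⟨EuclideanSpace.single j 1, 0, ?_⟩
    simpa [v, Pi.single_apply] using hj
  have hprob (i : Fin N) := isProbabilityMeasure_monGaussMarginal (hα i) hlam
  have htoLp : Measurable (WithLp.toLp 2 : (Fin N → ℝ) → EuclideanSpace ℝ (Fin N)) :=
    (PiLp.volume_preserving_toLp (Fin N)).measurable
  have hv : Measurable v := by fun_prop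
  rw [monGaussScaled_eq_map_pi hα hlam]
  have : IsProbabilityMeasure
      ((Measure.pi fun i => monGaussMarginal (α i) lam).map
        (WithLp.toLp 2 : (Fin N → ℝ) → EuclideanSpace ℝ (Fin N))) :=
    Measure.isProbabilityMeasure_map htoLp.aemeasurable
  have hmem (i : Fin N) : MemLp (fun t => aj i * t) 2 (monGaussMarginal (α i) lam) := by
    by_cases h : α i = 0
    · rw [h, monGaussMarginal_zero hlam]
      exact (ProbabilityTheory.memLp_id_gaussianReal (2 : NNReal)).const_mul _
    · simp [hsupp i h]
  have hvar (i : Fin N) : ProbabilityTheory.variance (fun t => aj i * t)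
      (monGaussMarginal (α i) lam) = aj i ^ 2 * lam ^ 2 := by
    rw [ProbabilityTheory.variance_const_mul]
    by_cases h : α i = 0
    · rw [h, monGaussMarginal_zero hlam,
        ProbabilityTheory.variance_fun_id_gaussianReal, Real.coe_toNNReal _ (sq_nonneg _)]
    · simp [hsupp i h]
  have hcomp : v ∘ WithLp.toLp 2 = fun y => a + (∑ j, fun y : Fin N → ℝ => aj j * y j) y := by
    ext y
    simp [v]
  have hsum : MemLp (∑ j, fun y : Fin N → ℝ => aj j * y j) 2
      (Measure.pi fun i => monGaussMarginal (α i) lam) :=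
    memLp_finsetSum' _ fun i _ =>
      (hmem i).comp_measurePreserving (measurePreserving_eval _ i)
  have hvmem : MemLp v 2 ((Measure.pi fun i => monGaussMarginal (α i) lam).map
      (WithLp.toLp 2)) := by
    rw [memLp_map_measure_iff hv.aestronglyMeasurable htoLp.aemeasurable, hcomp]
    exact (memLp_const a).add hsum
  rw [iInf_integral_sub_sq_eq_variance hvmem,
    ProbabilityTheory.variance_map hv.aemeasurable htoLp.aemeasurable, hcomp,
    ProbabilityTheory.variance_const_add hsum.1,
    ProbabilityTheory.variance_sum_pi (X := fun i t => aj i * t) hmem]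
  simp_rw [hvar, v, gradient_affine, EuclideanSpace.real_norm_sq_eq]
  rw [integral_const, ← Finset.sum_mul]
  simp only [probReal_univ, one_smul]
  field_simp
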